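/- Under the standing hypotheses in the context: if there is a faithful set of left integrals, then the range of T₁ equals {E·z : z ∈ A ⊗ A} and the range of T₃ equals {z·E : z ∈ A ⊗ A}; if there is a faithful set of right integrals, then the range of T₂ equals {z·E : z ∈ A ⊗ A} and the range of T₄ equals {E·z : z ∈ A ⊗ A}. -/

import Mathlib

open TensorProduct

/-- Slice map `id ⊗ ω` landing in the left tensor factor. -/
noncomputable def sL {B C : Type} [AddCommGroup B] [Module ℂ B] [AddCommGroup C] [Module ℂ C]
    (ω : C →ₗ[ℂ] ℂ) : (B ⊗[ℂ] C) →ₗ[ℂ] B :=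
  (TensorProduct.rid ℂ B).toLinearMap ∘ₗ LinearMap.lTensor B ω

/-- Slice map `ω ⊗ id` landing in the right tensor factor. -/
noncomputable def sR {B C : Type} [AddCommGroup B] [Module ℂ B] [AddCommGroup C] [Module ℂ C]
    (ω : B →ₗ[ℂ] ℂ) : (B ⊗[ℂ] C) →ₗ[ℂ] C :=
  (TensorProduct.lid ℂ C).toLinearMap ∘ₗ LinearMap.rTensor C ω

/-- `u ⊗ v ↦ u ⊗ (v ⊗ 1)`, placing `A ⊗ A` in legs 1 and 2 of the triple tensor product. -/
noncomputable def leg12 (A : Type) [Ring A] [Algebra ℂ A] :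
    (A ⊗[ℂ] A) →ₗ[ℂ] A ⊗[ℂ] (A ⊗[ℂ] A) :=
  TensorProduct.map LinearMap.id ((TensorProduct.mk ℂ A A).flip 1)

/-- `u ⊗ v ↦ u ⊗ (1 ⊗ v)`, placing `A ⊗ A` in legs 1 and 3 of the triple tensor product. -/
noncomputable def leg13 (A : Type) [Ring A] [Algebra ℂ A] :
    (A ⊗[ℂ] A) →ₗ[ℂ] A ⊗[ℂ] (A ⊗[ℂ] A) :=
  TensorProduct.map LinearMap.id (TensorProduct.mk ℂ A A 1)

/-- A left integral: a nonzero functional with `(id ⊗ φ)(Δ a) ∈ C` for all `a`. -/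
noncomputable def IsLeftIntegral (A : Type) [Ring A] [Algebra ℂ A] (Δ : A →ₗ[ℂ] A ⊗[ℂ] A)
    (C : Subalgebra ℂ A) (φ : A →ₗ[ℂ] ℂ) : Prop :=
  φ ≠ 0 ∧ ∀ a : A, sL φ (Δ a) ∈ C

/-- A right integral: a nonzero functional with `(ψ ⊗ id)(Δ a) ∈ B` for all `a`. -/
noncomputable def IsRightIntegral (A : Type) [Ring A] [Algebra ℂ A] (Δ : A →ₗ[ℂ] A ⊗[ℂ] A)
    (B : Subalgebra ℂ A) (ψ : A →ₗ[ℂ] ℂ) : Prop :=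
  ψ ≠ 0 ∧ ∀ a : A, sR ψ (Δ a) ∈ B

/-- There is a faithful set of left integrals. -/
noncomputable def FaithfulLeftIntegrals (A : Type) [Ring A] [Algebra ℂ A]
    (Δ : A →ₗ[ℂ] A ⊗[ℂ] A) (C : Subalgebra ℂ A) : Prop :=
  (∀ a : A, (∀ φ : A →ₗ[ℂ] ℂ, IsLeftIntegral A Δ C φ → ∀ b : A, φ (a * b) = 0) → a = 0) ∧
  (∀ a : A, (∀ φ : A →ₗ[ℂ] ℂ, IsLeftIntegral A Δ C φ → ∀ b : A, φ (b * a) = 0) → a = 0)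

/-- There is a faithful set of right integrals. -/
noncomputable def FaithfulRightIntegrals (A : Type) [Ring A] [Algebra ℂ A]
    (Δ : A →ₗ[ℂ] A ⊗[ℂ] A) (B : Subalgebra ℂ A) : Prop :=
  (∀ a : A, (∀ ψ : A →ₗ[ℂ] ℂ, IsRightIntegral A Δ B ψ → ∀ b : A, ψ (a * b) = 0) → a = 0) ∧
  (∀ a : A, (∀ ψ : A →ₗ[ℂ] ℂ, IsRightIntegral A Δ B ψ → ∀ b : A, ψ (b * a) = 0) → a = 0)

/-- `T₁ (a ⊗ b) = Δ(a) · (1 ⊗ b)`. -/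
noncomputable def Tmap1 (A : Type) [Ring A] [Algebra ℂ A] (Δ : A →ₗ[ℂ] A ⊗[ℂ] A) :
    (A ⊗[ℂ] A) →ₗ[ℂ] A ⊗[ℂ] A :=
  LinearMap.mul' ℂ (A ⊗[ℂ] A) ∘ₗ TensorProduct.map Δ (TensorProduct.mk ℂ A A 1)

/-- `T₂ (c ⊗ a) = (c ⊗ 1) · Δ(a)`. -/
noncomputable def Tmap2 (A : Type) [Ring A] [Algebra ℂ A] (Δ : A →ₗ[ℂ] A ⊗[ℂ] A) :
    (A ⊗[ℂ] A) →ₗ[ℂ] A ⊗[ℂ] A :=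
  LinearMap.mul' ℂ (A ⊗[ℂ] A) ∘ₗ TensorProduct.map ((TensorProduct.mk ℂ A A).flip 1) Δ

/-- `T₃ (a ⊗ b) = (1 ⊗ b) · Δ(a)`. -/
noncomputable def Tmap3 (A : Type) [Ring A] [Algebra ℂ A] (Δ : A →ₗ[ℂ] A ⊗[ℂ] A) :
    (A ⊗[ℂ] A) →ₗ[ℂ] A ⊗[ℂ] A :=
  (LinearMap.mul' ℂ (A ⊗[ℂ] A) ∘ₗ TensorProduct.map (TensorProduct.mk ℂ A A 1) Δ) ∘ₗ
    (TensorProduct.comm ℂ A A).toLinearMap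

/-- `T₄ (c ⊗ a) = Δ(a) · (c ⊗ 1)`. -/
noncomputable def Tmap4 (A : Type) [Ring A] [Algebra ℂ A] (Δ : A →ₗ[ℂ] A ⊗[ℂ] A) :
    (A ⊗[ℂ] A) →ₗ[ℂ] A ⊗[ℂ] A :=
  (LinearMap.mul' ℂ (A ⊗[ℂ] A) ∘ₗ TensorProduct.map Δ ((TensorProduct.mk ℂ A A).flip 1)) ∘ₗ
    (TensorProduct.comm ℂ A A).toLinearMap

section Slices

variable {V W X : Type} [AddCommGroup V] [Module ℂ V] [AddCommGroup W] [Module ℂ W]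
  [AddCommGroup X] [Module ℂ X]

@[simp]
theorem sL_tmul (ω : W →ₗ[ℂ] ℂ) (v : V) (w : W) : sL ω (v ⊗ₜ[ℂ] w) = ω w • v := by
  simp [sL]

@[simp]
theorem sR_tmul (ω : V →ₗ[ℂ] ℂ) (v : V) (w : W) : sR ω (v ⊗ₜ[ℂ] w) = ω v • w := by
  simp [sR]

theorem sL_comm (ω : V →ₗ[ℂ] ℂ) (z : V ⊗[ℂ] W) :
    sL ω (TensorProduct.comm ℂ V W z) = sR ω z := by
  induction z with
  | zero => simp
  | tmul x y => simp
  | add x y hx hy => simp only [map_add, hx, hy]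

theorem sR_comm (ω : W →ₗ[ℂ] ℂ) (z : V ⊗[ℂ] W) :
    sR ω (TensorProduct.comm ℂ V W z) = sL ω z := by
  induction z with
  | zero => simp
  | tmul x y => simp
  | add x y hx hy => simp only [map_add, hx, hy]

theorem apply_sL_eq_apply_sR (l : V →ₗ[ℂ] ℂ) (ω : W →ₗ[ℂ] ℂ) (z : V ⊗[ℂ] W) :
    l (sL ω z) = ω (sR l z) := by
  induction z with
  | zero => simp
  | tmul x y => simp [mul_comm]
  | add x y hx hy => simp only [map_add, hx, hy]

theorem sR_lTensor (ω : V →ₗ[ℂ] ℂ) (f : W →ₗ[ℂ] X) (z : V ⊗[ℂ] W) :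
    sR ω (LinearMap.lTensor V f z) = f (sR ω z) := by
  induction z with
  | zero => simp
  | tmul x y => simp
  | add x y hx hy => simp only [map_add, hx, hy]

theorem map_sL_eq_assoc (Δ : V →ₗ[ℂ] V ⊗[ℂ] V) (ω : V →ₗ[ℂ] ℂ) (z : V ⊗[ℂ] V) :
    Δ (sL ω z) = LinearMap.lTensor V (sL ω)
      (TensorProduct.assoc ℂ V V V (LinearMap.rTensor V Δ z)) := by
  induction z with
  | zero => simp
  | add x y hx hy => simp only [map_add, hx, hy]
  | tmul x y =>
    simp only [sL_tmul, map_smul, LinearMap.rTensor_tmul]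
    induction Δ x with
    | zero => simp
    | tmul p q => simp
    | add p q hp hq => simp only [smul_add, TensorProduct.add_tmul, map_add, hp, hq]

end Slices

section Comultiplication

variable {V : Type} [AddCommGroup V] [Module ℂ V]

/-- `p ⊗ q ↦ (y ↦ θ(q y) p)`. -/
noncomputable def sliceMul (m : V →ₗ[ℂ] V →ₗ[ℂ] V) (θ : V →ₗ[ℂ] ℂ) :
    V ⊗[ℂ] V →ₗ[ℂ] V →ₗ[ℂ] V :=
  TensorProduct.lift (LinearMap.mk₂ ℂ (fun p q => (θ ∘ₗ m q).smulRight p)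
    (by intros; ext; simp) (by intros; ext; simp [smul_smul, mul_comm])
    (by intros; ext; simp [add_smul]) (by intros; ext; simp [smul_smul]))

@[simp]
theorem sliceMul_tmul (m : V →ₗ[ℂ] V →ₗ[ℂ] V) (θ : V →ₗ[ℂ] ℂ) (p q y : V) :
    sliceMul m θ (p ⊗ₜ[ℂ] q) y = θ (m q y) • p := by
  simp [sliceMul]

theorem sliceMul_comp_flip (m : V →ₗ[ℂ] V →ₗ[ℂ] V)
    (hassoc : ∀ x y z, m (m x y) z = m x (m y z)) (θ : V →ₗ[ℂ] ℂ) (b : V) (K : V ⊗[ℂ] V) :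
    sliceMul m θ K ∘ₗ m.flip b = sliceMul m (θ ∘ₗ m.flip b) K := by
  ext y
  induction K with
  | zero => simp
  | tmul p q => simp [hassoc]
  | add p q hp hq =>
    simp only [map_add, LinearMap.add_apply, LinearMap.comp_apply] at hp hq ⊢
    rw [hp, hq]

theorem lTensor_sliceMul {B C : Type} [AddCommGroup B] [Module ℂ B] [AddCommGroup C]
    [Module ℂ C] (m : V →ₗ[ℂ] V →ₗ[ℂ] V) (s i : C →ₗ[ℂ] V) (t : B →ₗ[ℂ] V) (z : V ⊗[ℂ] V)
    (hs : ∀ c, LinearMap.lTensor V (m (i c)) z = LinearMap.rTensor V (m (s c)) z)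
    (u : B ⊗[ℂ] C) (θ : V →ₗ[ℂ] ℂ) :
    LinearMap.lTensor V (sliceMul m θ (TensorProduct.map t i u)) z =
      LinearMap.rTensor V (m.flip (sL θ z))
        (TensorProduct.map s t (TensorProduct.comm ℂ B C u)) := by
  induction u with
  | zero => simp
  | add x y hx hy => simp only [map_add, LinearMap.lTensor_add, LinearMap.add_apply, hx, hy]
  | tmul b c =>
    have h1 : LinearMap.lTensor V (sliceMul m θ (t b ⊗ₜ[ℂ] i c)) z =
        sL θ (LinearMap.lTensor V (m (i c)) z) ⊗ₜ[ℂ] t b := by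
      clear hs
      induction z with
      | zero => simp
      | tmul p q => simp [TensorProduct.smul_tmul]
      | add p q hp hq => simp only [map_add, hp, hq, TensorProduct.add_tmul]
    have h2 : sL θ (LinearMap.rTensor V (m (s c)) z) = m (s c) (sL θ z) := by
      clear hs h1
      induction z with
      | zero => simp
      | tmul p q => simp
      | add p q hp hq => simp only [map_add, hp, hq]
    simp [h1, hs, h2]

/-- Slicing `Δ₁₂ · (1 ⊗ w)` in the third leg gives elements of `Δ(V)(1 ⊗ V)`. -/
theorem lTensor_sL_mem_span (Δ : V →ₗ[ℂ] V ⊗[ℂ] V) (m : V →ₗ[ℂ] V →ₗ[ℂ] V)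
    (φ : V →ₗ[ℂ] ℂ) (z w : V ⊗[ℂ] V) :
    LinearMap.lTensor V (sL φ) (LinearMap.lTensor V ((TensorProduct.map₂ m m).flip w)
      (TensorProduct.assoc ℂ V V V (LinearMap.rTensor V Δ z))) ∈
      Submodule.span ℂ {x | ∃ a b, x = LinearMap.lTensor V (m.flip b) (Δ a)} := by
  induction w with
  | zero => simp
  | add x y hx hy =>
    simp only [map_add, LinearMap.lTensor_add, LinearMap.add_apply]
    exact add_mem hx hy
  | tmul b b' =>
    induction z with
    | zero => simp
    | add x y hx hy => simp only [map_add]; exact add_mem hx hy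
    | tmul a a' =>
      have : LinearMap.lTensor V (sL φ) (LinearMap.lTensor V
          ((TensorProduct.map₂ m m).flip (b ⊗ₜ[ℂ] b'))
          (TensorProduct.assoc ℂ V V V (LinearMap.rTensor V Δ (a ⊗ₜ[ℂ] a')))) =
          φ (m a' b') • LinearMap.lTensor V (m.flip b) (Δ a) := by
        rw [LinearMap.rTensor_tmul]
        induction Δ a with
        | zero => simp
        | tmul p q => simp
        | add p q hp hq => simp only [map_add, TensorProduct.add_tmul, smul_add, hp, hq]
      rw [this]
      exact Submodule.smul_mem _ _ (Submodule.subset_span ⟨a, b, rfl⟩)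

theorem span_slices_eq_top (Δ : V →ₗ[ℂ] V ⊗[ℂ] V) (m : V →ₗ[ℂ] V →ₗ[ℂ] V)
    (hfull : Submodule.span ℂ {x | ∃ ω : V →ₗ[ℂ] ℂ, ∃ a, x = sL ω (Δ a)} = ⊤)
    (Φ : Set (V →ₗ[ℂ] ℂ))
    (hfaithful : ∀ a, (∀ φ ∈ Φ, ∀ b, φ (m a b) = 0) → a = 0) :
    Submodule.span ℂ {x | ∃ φ ∈ Φ, ∃ a b, x = sL (φ ∘ₗ m.flip b) (Δ a)} = ⊤ := by
  by_contra hne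
  obtain ⟨l, hl0, hl⟩ := Submodule.exists_le_ker_of_lt_top _ (lt_top_iff_ne_top.mpr hne)
  have hz : ∀ a, sR l (Δ a) = 0 := fun a => hfaithful _ fun φ hφ b => by
    have := hl (Submodule.subset_span ⟨φ, hφ, a, b, rfl⟩)
    rw [LinearMap.mem_ker, apply_sL_eq_apply_sR] at this
    simpa using this
  apply hl0
  rw [← LinearMap.ker_eq_top, eq_top_iff, ← hfull, Submodule.span_le]
  rintro _ ⟨ω, a, rfl⟩
  simp [apply_sL_eq_apply_sR, hz]

/-- The elements `E(p ⊗ 1)` belong to `Δ(V)(1 ⊗ V)` when there are enough functionals `φ` whose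
slices `(id ⊗ φ)Δ(a)` satisfy `Δ(c) = E(c ⊗ 1)`. The product `m` may be the given one or its
opposite. -/
theorem rTensor_mem_span_of_faithful {B C : Type} [AddCommGroup B] [Module ℂ B] [AddCommGroup C]
    [Module ℂ C] (Δ : V →ₗ[ℂ] V ⊗[ℂ] V) (m : V →ₗ[ℂ] V →ₗ[ℂ] V)
    (hassoc : ∀ x y z, m (m x y) z = m x (m y z))
    (hmul : ∀ x y, Δ (m x y) = TensorProduct.map₂ m m (Δ x) (Δ y))
    (hcoassoc : ∀ a, TensorProduct.assoc ℂ V V V (LinearMap.rTensor V Δ (Δ a)) =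
      LinearMap.lTensor V Δ (Δ a))
    (hfullL : Submodule.span ℂ {x | ∃ ω : V →ₗ[ℂ] ℂ, ∃ a, x = sL ω (Δ a)} = ⊤)
    (hfullR : Submodule.span ℂ {x | ∃ ω : V →ₗ[ℂ] ℂ, ∃ a, x = sR ω (Δ a)} = ⊤)
    (E : V ⊗[ℂ] V) (s i : C →ₗ[ℂ] V) (t : B →ₗ[ℂ] V)
    (hs : ∀ c a, LinearMap.lTensor V (m (i c)) (Δ a) = LinearMap.rTensor V (m (s c)) (Δ a))
    (u : B ⊗[ℂ] C) (hu : TensorProduct.map s t (TensorProduct.comm ℂ B C u) = E)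
    (Φ : Set (V →ₗ[ℂ] ℂ))
    (hΦ : ∀ φ ∈ Φ, ∀ a, Δ (sL φ (Δ a)) = LinearMap.rTensor V (m.flip (sL φ (Δ a))) E)
    (hfaithful : ∀ a, (∀ φ ∈ Φ, ∀ b, φ (m a b) = 0) → a = 0) (p : V) :
    LinearMap.rTensor V (m.flip p) E ∈
      Submodule.span ℂ {x | ∃ a b, x = LinearMap.lTensor V (m.flip b) (Δ a)} := by
  have hp : p ∈ Submodule.span ℂ {x | ∃ φ ∈ Φ, ∃ a b, x = sL (φ ∘ₗ m.flip b) (Δ a)} := by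
    rw [span_slices_eq_top Δ m hfullL Φ hfaithful]
    trivial
  induction hp using Submodule.span_induction with
  | zero => simp
  | add x y _ _ hx hy =>
    simp only [map_add, LinearMap.rTensor_add, LinearMap.add_apply]
    exact add_mem hx hy
  | smul r x _ hx =>
    simp only [map_smul, LinearMap.rTensor_smul, LinearMap.smul_apply]
    exact Submodule.smul_mem _ _ hx
  | mem x hx =>
    obtain ⟨φ, hφ, a, b, rfl⟩ := hx
    set K := TensorProduct.map t i u with hK
    have hF : sL φ ∘ₗ Δ = sliceMul m φ K := by
      ext y
      have hy : y ∈ Submodule.span ℂ {x | ∃ ω : V →ₗ[ℂ] ℂ, ∃ a, x = sR ω (Δ a)} := by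
        rw [hfullR]
        trivial
      refine LinearMap.eqOn_span (f := sL φ ∘ₗ Δ) (g := sliceMul m φ K) ?_ hy
      rintro _ ⟨ω, y, rfl⟩
      rw [← sR_lTensor, ← sR_lTensor, hK, lTensor_sliceMul m s i t _ (fun c => hs c y) u φ, hu,
        ← hΦ φ hφ, map_sL_eq_assoc, hcoassoc, LinearMap.lTensor_comp, LinearMap.comp_apply]
    rw [← hu, ← lTensor_sliceMul m s i t _ (fun c => hs c a) u, ← hK,
      ← sliceMul_comp_flip m hassoc, ← hF]
    have hb : (sL φ ∘ₗ Δ) ∘ₗ m.flip b =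
        sL φ ∘ₗ (TensorProduct.map₂ m m).flip (Δ b) ∘ₗ Δ := by
      ext y
      simp [hmul]
    rw [hb, LinearMap.lTensor_comp, LinearMap.lTensor_comp, LinearMap.comp_apply,
      LinearMap.comp_apply, ← hcoassoc]
    exact lTensor_sL_mem_span Δ m φ _ _

theorem coassoc_comm (Δ : V →ₗ[ℂ] V ⊗[ℂ] V)
    (hcoassoc : ∀ a, TensorProduct.assoc ℂ V V V (LinearMap.rTensor V Δ (Δ a)) =
      LinearMap.lTensor V Δ (Δ a)) (a : V) :
    TensorProduct.assoc ℂ V V V (LinearMap.rTensor V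
        ((TensorProduct.comm ℂ V V).toLinearMap ∘ₗ Δ) (TensorProduct.comm ℂ V V (Δ a))) =
      LinearMap.lTensor V ((TensorProduct.comm ℂ V V).toLinearMap ∘ₗ Δ)
        (TensorProduct.comm ℂ V V (Δ a)) := by
  let R : V ⊗[ℂ] (V ⊗[ℂ] V) →ₗ[ℂ] V ⊗[ℂ] (V ⊗[ℂ] V) :=
    (TensorProduct.assoc ℂ V V V).toLinearMap ∘ₗ
      (TensorProduct.comm ℂ V (V ⊗[ℂ] V)).toLinearMap ∘ₗ
      LinearMap.lTensor V (TensorProduct.comm ℂ V V).toLinearMap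
  have h1 : ∀ z : V ⊗[ℂ] V, TensorProduct.assoc ℂ V V V (LinearMap.rTensor V
      ((TensorProduct.comm ℂ V V).toLinearMap ∘ₗ Δ) (TensorProduct.comm ℂ V V z)) =
      R (LinearMap.lTensor V Δ z) := by
    intro z
    induction z with
    | zero => simp
    | add x y hx hy => simp only [map_add, hx, hy]
    | tmul x y => simp [R]
  have h2 : ∀ z : V ⊗[ℂ] V, LinearMap.lTensor V
      ((TensorProduct.comm ℂ V V).toLinearMap ∘ₗ Δ) (TensorProduct.comm ℂ V V z) =
      R (TensorProduct.assoc ℂ V V V (LinearMap.rTensor V Δ z)) := by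
    intro z
    induction z with
    | zero => simp
    | add x y hx hy => simp only [map_add, hx, hy]
    | tmul x y =>
      simp only [TensorProduct.comm_tmul, LinearMap.lTensor_tmul, LinearMap.rTensor_tmul,
        LinearMap.comp_apply, LinearEquiv.coe_coe]
      induction Δ x with
      | zero => simp
      | tmul p q => simp [R]
      | add p q hp hq => simp only [map_add, TensorProduct.tmul_add, TensorProduct.add_tmul, hp, hq]
  rw [h1, h2, hcoassoc]

theorem map₂_flip_flip (m : V →ₗ[ℂ] V →ₗ[ℂ] V) (z w : V ⊗[ℂ] V) :
    TensorProduct.map₂ m.flip m.flip z w = TensorProduct.map₂ m m w z := by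
  induction z with
  | zero => simp
  | add x y hx hy => simp only [map_add, LinearMap.add_apply, hx, hy]
  | tmul x y =>
    induction w with
    | zero => simp
    | add x y hx hy => simp only [map_add, LinearMap.add_apply, hx, hy]
    | tmul x y => simp

theorem comm_map₂ (m : V →ₗ[ℂ] V →ₗ[ℂ] V) (z w : V ⊗[ℂ] V) :
    TensorProduct.comm ℂ V V (TensorProduct.map₂ m m z w) =
      TensorProduct.map₂ m m (TensorProduct.comm ℂ V V z) (TensorProduct.comm ℂ V V w) := by
  induction z with
  | zero => simp
  | add x y hx hy => simp only [map_add, LinearMap.add_apply, hx, hy]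
  | tmul x y =>
    induction w with
    | zero => simp
    | add x y hx hy => simp only [map_add, hx, hy]
    | tmul x y => simp

theorem lTensor_comm (f : V →ₗ[ℂ] V) (z : V ⊗[ℂ] V) :
    LinearMap.lTensor V f (TensorProduct.comm ℂ V V z) =
      TensorProduct.comm ℂ V V (LinearMap.rTensor V f z) := by
  induction z with
  | zero => simp
  | add x y hx hy => simp only [map_add, hx, hy]
  | tmul x y => simp

theorem rTensor_comm (f : V →ₗ[ℂ] V) (z : V ⊗[ℂ] V) :
    LinearMap.rTensor V f (TensorProduct.comm ℂ V V z) =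
      TensorProduct.comm ℂ V V (LinearMap.lTensor V f z) := by
  induction z with
  | zero => simp
  | add x y hx hy => simp only [map_add, hx, hy]
  | tmul x y => simp

end Comultiplication

section Separability

variable {B C : Type} [Ring B] [Algebra ℂ B] [Ring C] [Algebra ℂ C]

/-- A separability idempotent is invariant under the flip composed with its antipodal maps. -/
theorem map_antipodal_comm_eq (E : B ⊗[ℂ] C) (hEE : E * E = E)
    (hfull : Submodule.span ℂ {x : B | ∃ ω : C →ₗ[ℂ] ℂ, x = sL ω E} = ⊤)
    (SB : B ≃ₗ[ℂ] C) (SC : C ≃ₗ[ℂ] B)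
    (hSB : ∀ b b', SB (b * b') = SB b' * SB b) (hSC : ∀ c c', SC (c * c') = SC c' * SC c)
    (hSBrel : ∀ b : B, E * (b ⊗ₜ[ℂ] (1 : C)) = E * ((1 : B) ⊗ₜ[ℂ] SB b))
    (hSCrel : ∀ c : C, ((1 : B) ⊗ₜ[ℂ] c) * E = (SC c ⊗ₜ[ℂ] (1 : C)) * E) :
    TensorProduct.map SC.toLinearMap SB.toLinearMap (TensorProduct.comm ℂ B C E) = E := by
  set Θ : B ⊗[ℂ] C →ₗ[ℂ] B ⊗[ℂ] C :=
    TensorProduct.map SC.toLinearMap SB.toLinearMap ∘ₗ (TensorProduct.comm ℂ B C).toLinearMap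
    with hΘ
  have hΘt : ∀ b c, Θ (b ⊗ₜ[ℂ] c) = SC c ⊗ₜ[ℂ] SB b := by simp [hΘ]
  change Θ E = E
  let μ : B ⊗[ℂ] C →ₗ[ℂ] B := LinearMap.mul' ℂ B ∘ₗ LinearMap.lTensor B SC.toLinearMap
  have hμt : ∀ b c, μ (b ⊗ₜ[ℂ] c) = b * SC c := by simp [μ]
  have hSB1 : SB 1 = 1 := by
    obtain ⟨b, hb⟩ := SB.surjective 1
    have := hSB b 1
    rw [mul_one, hb, mul_one] at this
    exact this.symm
  have hleft : ∀ X : B ⊗[ℂ] C,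
      (∀ c : C, ((1 : B) ⊗ₜ[ℂ] c) * X = (SC c ⊗ₜ[ℂ] (1 : C)) * X) →
      ∀ u, u * X = (μ u ⊗ₜ[ℂ] (1 : C)) * X := by
    intro X hX u
    induction u with
    | zero => simp
    | add x y hx hy => simp only [add_mul, map_add, TensorProduct.add_tmul, hx, hy]
    | tmul b c =>
      have : b ⊗ₜ[ℂ] c = (b ⊗ₜ[ℂ] (1 : C)) * ((1 : B) ⊗ₜ[ℂ] c) := by simp
      rw [this, mul_assoc, hX, ← mul_assoc, ← this, hμt]
      simp
  have hright : ∀ u, E * Θ u = E * ((1 : B) ⊗ₜ[ℂ] SB (μ u)) := by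
    intro u
    induction u with
    | zero => simp
    | add x y hx hy => simp only [map_add, mul_add, TensorProduct.tmul_add, hx, hy]
    | tmul b c =>
      have : SC c ⊗ₜ[ℂ] SB b = (SC c ⊗ₜ[ℂ] (1 : C)) * ((1 : B) ⊗ₜ[ℂ] SB b) := by simp
      rw [hΘt, this, ← mul_assoc, hSBrel, mul_assoc, hμt, hSB]
      simp
  have hslice : ∀ (ω : C →ₗ[ℂ] ℂ) (b : B) (z : B ⊗[ℂ] C),
      sL ω ((b ⊗ₜ[ℂ] (1 : C)) * z) = b * sL ω z := by
    intro ω b z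
    induction z with
    | zero => simp
    | add x y hx hy => simp only [map_add, mul_add, hx, hy]
    | tmul x y => simp
  have hμE : μ E = 1 := by
    have h1 : (1 : B) ∈ Submodule.span ℂ {x : B | ∃ ω : C →ₗ[ℂ] ℂ, x = sL ω E} := by
      rw [hfull]
      trivial
    have h2 := LinearMap.eqOn_span (f := LinearMap.mulLeft ℂ (μ E)) (g := LinearMap.id)
      (s := {x : B | ∃ ω : C →ₗ[ℂ] ℂ, x = sL ω E}) (by
        rintro _ ⟨ω, rfl⟩
        simp [← hslice, ← hleft E hSCrel, hEE]) h1
    simpa using h2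
  have hΘl : ∀ b u, Θ (u * (b ⊗ₜ[ℂ] (1 : C))) = ((1 : B) ⊗ₜ[ℂ] SB b) * Θ u := by
    intro b u
    induction u with
    | zero => simp
    | add x y hx hy => simp only [map_add, add_mul, mul_add, hx, hy]
    | tmul x y => simp [hΘt, hSB]
  have hΘr : ∀ c u, Θ (u * ((1 : B) ⊗ₜ[ℂ] c)) = (SC c ⊗ₜ[ℂ] (1 : C)) * Θ u := by
    intro c u
    induction u with
    | zero => simp
    | add x y hx hy => simp only [map_add, add_mul, mul_add, hx, hy]
    | tmul x y => simp [hΘt, hSC]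
  have hΘrel : ∀ c : C, ((1 : B) ⊗ₜ[ℂ] c) * Θ E = (SC c ⊗ₜ[ℂ] (1 : C)) * Θ E := by
    intro c
    obtain ⟨b, rfl⟩ := SB.surjective c
    rw [← hΘl, ← hΘr, hSBrel]
  have h1 := hleft (Θ E) hΘrel E
  have h2 := hright E
  rw [hμE, ← Algebra.TensorProduct.one_def, one_mul] at h1
  rw [hμE, hSB1, ← Algebra.TensorProduct.one_def, mul_one] at h2
  rw [← h1, h2]

end Separability

section Algebra

variable {A : Type} [Ring A] [Algebra ℂ A]

theorem mul_eq_map₂ (z w : A ⊗[ℂ] A) :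
    z * w = TensorProduct.map₂ (LinearMap.mul ℂ A) (LinearMap.mul ℂ A) z w := by
  induction z with
  | zero => simp
  | add x y hx hy => simp only [map_add, add_mul, LinearMap.add_apply, hx, hy]
  | tmul x y =>
    induction w with
    | zero => simp
    | add x y hx hy => simp only [map_add, mul_add, hx, hy]
    | tmul x y => simp

theorem lTensor_mul (b : A) (z : A ⊗[ℂ] A) :
    LinearMap.lTensor A (LinearMap.mul ℂ A b) z = ((1 : A) ⊗ₜ[ℂ] b) * z := by
  induction z with
  | zero => simp
  | add x y hx hy => simp only [map_add, mul_add, hx, hy]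
  | tmul x y => simp

theorem lTensor_mul_flip (b : A) (z : A ⊗[ℂ] A) :
    LinearMap.lTensor A ((LinearMap.mul ℂ A).flip b) z = z * ((1 : A) ⊗ₜ[ℂ] b) := by
  induction z with
  | zero => simp
  | add x y hx hy => simp only [map_add, add_mul, hx, hy]
  | tmul x y => simp

theorem rTensor_mul (b : A) (z : A ⊗[ℂ] A) :
    LinearMap.rTensor A (LinearMap.mul ℂ A b) z = (b ⊗ₜ[ℂ] (1 : A)) * z := by
  induction z with
  | zero => simp
  | add x y hx hy => simp only [map_add, mul_add, hx, hy]
  | tmul x y => simp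

theorem rTensor_mul_flip (b : A) (z : A ⊗[ℂ] A) :
    LinearMap.rTensor A ((LinearMap.mul ℂ A).flip b) z = z * (b ⊗ₜ[ℂ] (1 : A)) := by
  induction z with
  | zero => simp
  | add x y hx hy => simp only [map_add, add_mul, hx, hy]
  | tmul x y => simp

theorem map_one_eq (Δ : A →ₗ[ℂ] A ⊗[ℂ] A) (hmul : ∀ a a', Δ (a * a') = Δ a * Δ a')
    (E : A ⊗[ℂ] A) (hE : ∀ a, Δ a * E = Δ a)
    (hran : (Submodule.span ℂ {y : A ⊗[ℂ] A | ∃ a z, y = Δ a * z} : Set (A ⊗[ℂ] A)) =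
      {y : A ⊗[ℂ] A | ∃ z, y = E * z}) : Δ 1 = E := by
  have hmem : E ∈ Submodule.span ℂ {y : A ⊗[ℂ] A | ∃ a z, y = Δ a * z} := by
    rw [← SetLike.mem_coe, hran]
    exact ⟨1, by simp⟩
  have h := LinearMap.eqOn_span (f := LinearMap.mulLeft ℂ (Δ 1)) (g := LinearMap.id)
    (s := {y : A ⊗[ℂ] A | ∃ a z, y = Δ a * z}) (by
      rintro _ ⟨a, z, rfl⟩
      simp [← mul_assoc, ← hmul]) hmem
  simpa [hE] using h

theorem sR_leg12_mul (ω : A →ₗ[ℂ] ℂ) (z w : A ⊗[ℂ] A) :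
    sR ω (leg12 A z * ((1 : A) ⊗ₜ[ℂ] w)) = (sR ω z ⊗ₜ[ℂ] (1 : A)) * w := by
  induction z with
  | zero => simp
  | add x y hx hy => simp only [map_add, add_mul, TensorProduct.add_tmul, hx, hy]
  | tmul x y => simp [leg12, ← TensorProduct.smul_tmul']

theorem sR_mul_leg12 (ω : A →ₗ[ℂ] ℂ) (z w : A ⊗[ℂ] A) :
    sR ω (((1 : A) ⊗ₜ[ℂ] w) * leg12 A z) = w * (sR ω z ⊗ₜ[ℂ] (1 : A)) := by
  induction z with
  | zero => simp
  | add x y hx hy => simp only [map_add, mul_add, TensorProduct.add_tmul, hx, hy]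
  | tmul x y => simp [leg12, ← TensorProduct.smul_tmul']

theorem lTensor_sL_leg12_mul (ω : A →ₗ[ℂ] ℂ) (z w : A ⊗[ℂ] A) :
    LinearMap.lTensor A (sL ω) (leg12 A z * ((1 : A) ⊗ₜ[ℂ] w)) =
      z * ((1 : A) ⊗ₜ[ℂ] sL ω w) := by
  induction z with
  | zero => simp
  | add x y hx hy => simp only [map_add, add_mul, hx, hy]
  | tmul x y =>
    induction w with
    | zero => simp
    | add p q hp hq => simp only [map_add, mul_add, TensorProduct.tmul_add, hp, hq]
    | tmul p q => simp [leg12]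

theorem lTensor_sL_mul_leg12 (ω : A →ₗ[ℂ] ℂ) (z w : A ⊗[ℂ] A) :
    LinearMap.lTensor A (sL ω) (((1 : A) ⊗ₜ[ℂ] w) * leg12 A z) =
      ((1 : A) ⊗ₜ[ℂ] sL ω w) * z := by
  induction z with
  | zero => simp
  | add x y hx hy => simp only [map_add, mul_add, hx, hy]
  | tmul x y =>
    induction w with
    | zero => simp
    | add p q hp hq => simp only [map_add, add_mul, TensorProduct.tmul_add, hp, hq]
    | tmul p q => simp [leg12]

theorem exists_sR_extend (B C : Subalgebra ℂ A) (z : B ⊗[ℂ] C) (ω : B →ₗ[ℂ] ℂ) :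
    ∃ ω' : A →ₗ[ℂ] ℂ, ((sR ω z : C) : A) =
      sR ω' (TensorProduct.map B.val.toLinearMap C.val.toLinearMap z) := by
  obtain ⟨ω', h⟩ := LinearMap.exists_extend (p := Subalgebra.toSubmodule B) ω
  refine ⟨ω', ?_⟩
  have h' : ∀ b : B, ω' b = ω b := fun b => LinearMap.congr_fun h b
  induction z with
  | zero => simp
  | add x y hx hy => simp only [map_add, Subalgebra.coe_add, hx, hy]
  | tmul x y => simp [h']

theorem exists_sL_extend (B C : Subalgebra ℂ A) (z : B ⊗[ℂ] C) (ω : C →ₗ[ℂ] ℂ) :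
    ∃ ω' : A →ₗ[ℂ] ℂ, ((sL ω z : B) : A) =
      sL ω' (TensorProduct.map B.val.toLinearMap C.val.toLinearMap z) := by
  obtain ⟨ω', h⟩ := LinearMap.exists_extend (p := Subalgebra.toSubmodule C) ω
  refine ⟨ω', ?_⟩
  have h' : ∀ c : C, ω' c = ω c := fun c => LinearMap.congr_fun h c
  induction z with
  | zero => simp
  | add x y hx hy => simp only [map_add, Subalgebra.coe_add, hx, hy]
  | tmul x y => simp [h']

/-- `Δ(c) = (c ⊗ 1)E = E(c ⊗ 1)` for `c` in the right leg `C` of `E`. -/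
theorem comul_right_leg (Δ : A →ₗ[ℂ] A ⊗[ℂ] A) (E : A ⊗[ℂ] A)
    (hE1 : LinearMap.lTensor A Δ E = leg12 A E * ((1 : A) ⊗ₜ[ℂ] E))
    (hE2 : leg12 A E * ((1 : A) ⊗ₜ[ℂ] E) = ((1 : A) ⊗ₜ[ℂ] E) * leg12 A E)
    (B C : Subalgebra ℂ A) (E' : B ⊗[ℂ] C)
    (hE' : TensorProduct.map B.val.toLinearMap C.val.toLinearMap E' = E)
    (hfull : Submodule.span ℂ {y : C | ∃ ω : B →ₗ[ℂ] ℂ, y = sR ω E'} = ⊤) (c : C) :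
    Δ c = ((c : A) ⊗ₜ[ℂ] (1 : A)) * E ∧ Δ c = E * ((c : A) ⊗ₜ[ℂ] (1 : A)) := by
  have hc : c ∈ Submodule.span ℂ {y : C | ∃ ω : B →ₗ[ℂ] ℂ, y = sR ω E'} := by
    rw [hfull]
    trivial
  induction hc using Submodule.span_induction with
  | zero => simp
  | add x y _ _ hx hy =>
    simp only [Subalgebra.coe_add, map_add, TensorProduct.add_tmul, add_mul, mul_add]
    exact ⟨by rw [hx.1, hy.1], by rw [hx.2, hy.2]⟩
  | smul r x _ hx =>
    simp only [Subalgebra.coe_smul, map_smul, ← TensorProduct.smul_tmul', smul_mul_assoc,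
      mul_smul_comm]
    exact ⟨by rw [hx.1], by rw [hx.2]⟩
  | mem x hx =>
    obtain ⟨ω, rfl⟩ := hx
    obtain ⟨ω', h⟩ := exists_sR_extend B C E' ω
    rw [h, hE', ← sR_lTensor, hE1]
    exact ⟨sR_leg12_mul _ _ _, by rw [hE2, sR_mul_leg12]⟩

/-- `Δ(b) = (1 ⊗ b)E = E(1 ⊗ b)` for `b` in the left leg `B` of `E`. -/
theorem comul_left_leg (Δ : A →ₗ[ℂ] A ⊗[ℂ] A) (E : A ⊗[ℂ] A)
    (hE1 : TensorProduct.assoc ℂ A A A (LinearMap.rTensor A Δ E) =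
      leg12 A E * ((1 : A) ⊗ₜ[ℂ] E))
    (hE2 : leg12 A E * ((1 : A) ⊗ₜ[ℂ] E) = ((1 : A) ⊗ₜ[ℂ] E) * leg12 A E)
    (B C : Subalgebra ℂ A) (E' : B ⊗[ℂ] C)
    (hE' : TensorProduct.map B.val.toLinearMap C.val.toLinearMap E' = E)
    (hfull : Submodule.span ℂ {x : B | ∃ ω : C →ₗ[ℂ] ℂ, x = sL ω E'} = ⊤) (b : B) :
    Δ b = ((1 : A) ⊗ₜ[ℂ] (b : A)) * E ∧ Δ b = E * ((1 : A) ⊗ₜ[ℂ] (b : A)) := by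
  have hb : b ∈ Submodule.span ℂ {x : B | ∃ ω : C →ₗ[ℂ] ℂ, x = sL ω E'} := by
    rw [hfull]
    trivial
  induction hb using Submodule.span_induction with
  | zero => simp
  | add x y _ _ hx hy =>
    simp only [Subalgebra.coe_add, map_add, TensorProduct.tmul_add, add_mul, mul_add]
    exact ⟨by rw [hx.1, hy.1], by rw [hx.2, hy.2]⟩
  | smul r x _ hx =>
    simp only [Subalgebra.coe_smul, map_smul, TensorProduct.tmul_smul, smul_mul_assoc,
      mul_smul_comm]
    exact ⟨by rw [hx.1], by rw [hx.2]⟩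
  | mem x hx =>
    obtain ⟨ω, rfl⟩ := hx
    obtain ⟨ω', h⟩ := exists_sL_extend B C E' ω
    rw [h, hE', map_sL_eq_assoc, hE1]
    exact ⟨by rw [hE2, lTensor_sL_mul_leg12], lTensor_sL_leg12_mul _ _ _⟩

theorem range_eq_mul_left (T : A ⊗[ℂ] A →ₗ[ℂ] A ⊗[ℂ] A) (E : A ⊗[ℂ] A)
    (hle : ∀ x y, E * T (x ⊗ₜ[ℂ] y) = T (x ⊗ₜ[ℂ] y))
    (hge : ∀ p q, E * (p ⊗ₜ[ℂ] q) ∈ LinearMap.range T) :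
    Set.range T = {y : A ⊗[ℂ] A | ∃ z, y = E * z} := by
  ext y
  constructor
  · rintro ⟨z, rfl⟩
    refine ⟨T z, ?_⟩
    induction z with
    | zero => simp
    | add x y hx hy => rw [map_add, mul_add, ← hx, ← hy]
    | tmul x y => exact (hle x y).symm
  · rintro ⟨z, rfl⟩
    change E * z ∈ LinearMap.range T
    induction z with
    | zero => simp
    | add x y hx hy => rw [mul_add]; exact add_mem hx hy
    | tmul x y => exact hge x y

theorem range_eq_mul_right (T : A ⊗[ℂ] A →ₗ[ℂ] A ⊗[ℂ] A) (E : A ⊗[ℂ] A)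
    (hle : ∀ x y, T (x ⊗ₜ[ℂ] y) * E = T (x ⊗ₜ[ℂ] y))
    (hge : ∀ p q, (p ⊗ₜ[ℂ] q) * E ∈ LinearMap.range T) :
    Set.range T = {y : A ⊗[ℂ] A | ∃ z, y = z * E} := by
  ext y
  constructor
  · rintro ⟨z, rfl⟩
    refine ⟨T z, ?_⟩
    induction z with
    | zero => simp
    | add x y hx hy => rw [map_add, add_mul, ← hx, ← hy]
    | tmul x y => exact (hle x y).symm
  · rintro ⟨z, rfl⟩
    change z * E ∈ LinearMap.range T
    induction z with
    | zero => simp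
    | add x y hx hy => rw [add_mul]; exact add_mem hx hy
    | tmul x y => exact hge x y

end Algebra

theorem statement13
    (A : Type) [Ring A] [Algebra ℂ A]
    (Δ : A →ₗ[ℂ] A ⊗[ℂ] A)
    (hΔmul : ∀ a a' : A, Δ (a * a') = Δ a * Δ a')
    (hΔcoassoc : ∀ a : A,
      TensorProduct.assoc ℂ A A A (LinearMap.rTensor A Δ (Δ a)) = LinearMap.lTensor A Δ (Δ a))
    (hΔfullL : Submodule.span ℂ {x : A | ∃ ω : A →ₗ[ℂ] ℂ, ∃ a : A, x = sL ω (Δ a)} = ⊤)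
    (hΔfullR : Submodule.span ℂ {x : A | ∃ ω : A →ₗ[ℂ] ℂ, ∃ a : A, x = sR ω (Δ a)} = ⊤)
    (E : A ⊗[ℂ] A)
    (hEE : E * E = E)
    (hEΔ : ∀ a : A, E * Δ a = Δ a ∧ Δ a * E = Δ a)
    (hranL : (Submodule.span ℂ {y : A ⊗[ℂ] A | ∃ a z, y = Δ a * z} : Set (A ⊗[ℂ] A)) =
      {y : A ⊗[ℂ] A | ∃ z, y = E * z})
    (hranR : (Submodule.span ℂ {y : A ⊗[ℂ] A | ∃ a z, y = z * Δ a} : Set (A ⊗[ℂ] A)) =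
      {y : A ⊗[ℂ] A | ∃ z, y = z * E})
    (hΔE1 : TensorProduct.assoc ℂ A A A (LinearMap.rTensor A Δ E) =
      leg12 A E * ((1 : A) ⊗ₜ[ℂ] E))
    (hΔE2 : leg12 A E * ((1 : A) ⊗ₜ[ℂ] E) = ((1 : A) ⊗ₜ[ℂ] E) * leg12 A E)
    (B C : Subalgebra ℂ A)
    (E' : ↥B ⊗[ℂ] ↥C)
    (hE'E : TensorProduct.map B.val.toLinearMap C.val.toLinearMap E' = E)
    (hE'full1 : Submodule.span ℂ {x : ↥B | ∃ ω : ↥C →ₗ[ℂ] ℂ, x = sL ω E'} = ⊤)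
    (hE'full2 : Submodule.span ℂ {y : ↥C | ∃ ω : ↥B →ₗ[ℂ] ℂ, y = sR ω E'} = ⊤)
    (SB : ↥B ≃ₗ[ℂ] ↥C) (SC : ↥C ≃ₗ[ℂ] ↥B)
    (hSBanti : ∀ b b' : ↥B, SB (b * b') = SB b' * SB b)
    (hSCanti : ∀ c c' : ↥C, SC (c * c') = SC c' * SC c)
    (hSBrel : ∀ b : ↥B, E' * (b ⊗ₜ[ℂ] (1 : ↥C)) = E' * ((1 : ↥B) ⊗ₜ[ℂ] SB b))
    (hSCrel : ∀ c : ↥C, ((1 : ↥B) ⊗ₜ[ℂ] c) * E' = (SC c ⊗ₜ[ℂ] (1 : ↥C)) * E')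
 :
    (FaithfulLeftIntegrals A Δ C →
      Set.range (Tmap1 A Δ) = {y : A ⊗[ℂ] A | ∃ z, y = E * z} ∧
      Set.range (Tmap3 A Δ) = {y : A ⊗[ℂ] A | ∃ z, y = z * E}) ∧
    (FaithfulRightIntegrals A Δ B →
      Set.range (Tmap2 A Δ) = {y : A ⊗[ℂ] A | ∃ z, y = z * E} ∧
      Set.range (Tmap4 A Δ) = {y : A ⊗[ℂ] A | ∃ z, y = E * z}) := by
  have hinj : Function.Injective (Algebra.TensorProduct.map B.val C.val) :=
    TensorProduct.map_injective_of_flat_flat B.val.toLinearMap C.val.toLinearMap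
      Subtype.val_injective Subtype.val_injective
  have hjE : Algebra.TensorProduct.map B.val C.val E' = E := hE'E
  have hE'E' : E' * E' = E' := hinj (by rw [map_mul, hjE, hEE])
  have hG := map_antipodal_comm_eq E' hE'E' hE'full1 SB SC hSBanti hSCanti hSBrel hSCrel
  have hG' : TensorProduct.map SB.symm.toLinearMap SC.symm.toLinearMap
      (TensorProduct.comm ℂ B C E') = E' := by
    have h : ∀ u : B ⊗[ℂ] C, TensorProduct.map SB.symm.toLinearMap SC.symm.toLinearMap
        (TensorProduct.comm ℂ B C (TensorProduct.map SC.toLinearMap SB.toLinearMap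
          (TensorProduct.comm ℂ B C u))) = u := by
      intro u
      induction u with
      | zero => simp
      | add x y hx hy => simp only [map_add, hx, hy]
      | tmul x y => simp
    have := h E'
    rwa [hG] at this
  have hleft : ∀ (c : C) (a : A),
      ((1 : A) ⊗ₜ[ℂ] (c : A)) * Δ a = ((SC c : A) ⊗ₜ[ℂ] (1 : A)) * Δ a := by
    intro c a
    have h := congrArg (Algebra.TensorProduct.map B.val C.val) (hSCrel c)
    simp only [map_mul, hjE, Algebra.TensorProduct.map_tmul, map_one, Subalgebra.coe_val] at h
    rw [← (hEΔ a).1, ← mul_assoc, h, mul_assoc]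
  have hright : ∀ (b : B) (a : A),
      Δ a * ((b : A) ⊗ₜ[ℂ] (1 : A)) = Δ a * ((1 : A) ⊗ₜ[ℂ] (SB b : A)) := by
    intro b a
    have h := congrArg (Algebra.TensorProduct.map B.val C.val) (hSBrel b)
    simp only [map_mul, hjE, Algebra.TensorProduct.map_tmul, map_one, Subalgebra.coe_val] at h
    rw [← (hEΔ a).2, mul_assoc, h, mul_assoc]
  have hΔ1 := map_one_eq Δ hΔmul E (fun a => (hEΔ a).2) hranL
  have hlE : LinearMap.lTensor A Δ E = leg12 A E * ((1 : A) ⊗ₜ[ℂ] E) := by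
    rw [← hΔE1, ← hΔ1, hΔcoassoc]
  have hC := comul_right_leg Δ E hlE hΔE2 B C E' hE'E hE'full2
  have hB := comul_left_leg Δ E hΔE1 hΔE2 B C E' hE'E hE'full1
  set m := LinearMap.mul ℂ A with hm
  have hmul : ∀ x y, Δ (m x y) = TensorProduct.map₂ m m (Δ x) (Δ y) := fun x y => by
    rw [hm, ← mul_eq_map₂, ← hΔmul, LinearMap.mul_apply']
  set σ := TensorProduct.comm ℂ A A with hσ
  have hσσ : ∀ z, σ (σ z) = z := fun z => by simp [hσ]
  have hmapσ : ∀ {M N : Type} [AddCommGroup M] [Module ℂ M] [AddCommGroup N] [Module ℂ N]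
      (f : M →ₗ[ℂ] A) (g : N →ₗ[ℂ] A) (u : M ⊗[ℂ] N),
      TensorProduct.map g f (TensorProduct.comm ℂ M N u) = σ (TensorProduct.map f g u) :=
    fun f g u => TensorProduct.map_comm g f u
  have hmapG : TensorProduct.map (B.val.toLinearMap ∘ₗ SC.toLinearMap)
      (C.val.toLinearMap ∘ₗ SB.toLinearMap) (TensorProduct.comm ℂ B C E') = E := by
    rw [TensorProduct.map_comp, LinearMap.comp_apply, hG, hE'E]
  have hmapG' : TensorProduct.map (B.val.toLinearMap ∘ₗ SB.symm.toLinearMap)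
      (C.val.toLinearMap ∘ₗ SC.symm.toLinearMap) (TensorProduct.comm ℂ B C E') = E := by
    rw [TensorProduct.map_comp, LinearMap.comp_apply, hG', hE'E]
  have hcoσ := coassoc_comm Δ hΔcoassoc
  have hfullσL : Submodule.span ℂ {x : A | ∃ ω : A →ₗ[ℂ] ℂ, ∃ a : A,
      x = sL ω ((σ.toLinearMap ∘ₗ Δ) a)} = ⊤ := by
    simpa [hσ, sL_comm] using hΔfullR
  have hfullσR : Submodule.span ℂ {x : A | ∃ ω : A →ₗ[ℂ] ℂ, ∃ a : A,
      x = sR ω ((σ.toLinearMap ∘ₗ Δ) a)} = ⊤ := by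
    simpa [hσ, sR_comm] using hΔfullL
  refine ⟨fun hφ => ⟨range_eq_mul_left _ _ ?_ ?_, range_eq_mul_right _ _ ?_ ?_⟩,
    fun hψ => ⟨range_eq_mul_right _ _ ?_ ?_, range_eq_mul_left _ _ ?_ ?_⟩⟩
  · intro x y
    simp [Tmap1, ← mul_assoc, (hEΔ _).1]
  · intro p q
    have key := rTensor_mem_span_of_faithful Δ m (fun x y z => mul_assoc x y z)
      hmul hΔcoassoc hΔfullL hΔfullR E
      (B.val.toLinearMap ∘ₗ SC.toLinearMap) C.val.toLinearMap
      (C.val.toLinearMap ∘ₗ SB.toLinearMap)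
      (fun c a => by rw [lTensor_mul, rTensor_mul]; exact hleft c a) E' hmapG
      {φ | IsLeftIntegral A Δ C φ}
      (fun φ h a => by rw [rTensor_mul_flip]; exact (hC ⟨_, h.2 a⟩).2) hφ.1 p
    have hpq : E * (p ⊗ₜ[ℂ] q) =
        LinearMap.mulRight ℂ ((1 : A) ⊗ₜ[ℂ] q) (LinearMap.rTensor A (m.flip p) E) := by
      rw [rTensor_mul_flip, LinearMap.mulRight_apply, mul_assoc]
      simp
    rw [hpq, ← Submodule.mem_comap]
    refine Submodule.span_le.mpr ?_ key
    rintro _ ⟨a, b, rfl⟩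
    exact ⟨a ⊗ₜ (b * q), by rw [lTensor_mul_flip]; simp [Tmap1, mul_assoc]⟩
  · intro x y
    simp [Tmap3, mul_assoc, (hEΔ _).2]
  · intro p q
    have key := rTensor_mem_span_of_faithful Δ m.flip (fun x y z => (mul_assoc z y x).symm)
      (fun x y => by rw [map₂_flip_flip]; exact hmul y x) hΔcoassoc hΔfullL hΔfullR E
      (B.val.toLinearMap ∘ₗ SB.symm.toLinearMap) C.val.toLinearMap
      (C.val.toLinearMap ∘ₗ SC.symm.toLinearMap)
      (fun c a => by
        rw [lTensor_mul_flip, rTensor_mul_flip]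
        simpa using (hright (SB.symm c) a).symm) E' hmapG'
      {φ | IsLeftIntegral A Δ C φ}
      (fun φ h a => by rw [LinearMap.flip_flip, rTensor_mul]; exact (hC ⟨_, h.2 a⟩).1) hφ.2 p
    have hpq : (p ⊗ₜ[ℂ] q) * E =
        LinearMap.mulLeft ℂ ((1 : A) ⊗ₜ[ℂ] q) (LinearMap.rTensor A (m.flip.flip p) E) := by
      rw [LinearMap.flip_flip, rTensor_mul, LinearMap.mulLeft_apply, ← mul_assoc]
      simp
    rw [hpq, ← Submodule.mem_comap]
    refine Submodule.span_le.mpr ?_ key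
    rintro _ ⟨a, b, rfl⟩
    exact ⟨a ⊗ₜ (q * b), by
      rw [LinearMap.flip_flip, lTensor_mul]; simp [Tmap3, ← mul_assoc]⟩
  · intro x y
    simp [Tmap2, mul_assoc, (hEΔ _).2]
  · intro p q
    have key := rTensor_mem_span_of_faithful (σ.toLinearMap ∘ₗ Δ) m.flip
      (fun x y z => (mul_assoc z y x).symm)
      (fun x y => by
        rw [map₂_flip_flip]
        exact (congrArg σ (hmul y x)).trans (comm_map₂ m _ _))
      hcoσ hfullσL hfullσR (σ E)
      (C.val.toLinearMap ∘ₗ SB.toLinearMap) B.val.toLinearMap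
      (B.val.toLinearMap ∘ₗ SC.toLinearMap)
      (fun b a => by
        rw [LinearMap.comp_apply, LinearEquiv.coe_coe, lTensor_comm, rTensor_comm,
          rTensor_mul_flip, lTensor_mul_flip]
        exact congrArg σ (hright b a)) (TensorProduct.comm ℂ B C E')
      (by rw [hmapσ, hmapG])
      {φ | IsRightIntegral A Δ B φ}
      (fun φ h a => by
        rw [LinearMap.comp_apply, LinearMap.comp_apply, LinearEquiv.coe_coe, sL_comm,
          LinearMap.flip_flip, rTensor_comm, lTensor_mul]
        exact congrArg σ (hB ⟨_, h.2 a⟩).1) hψ.2 q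
    have hpq : (p ⊗ₜ[ℂ] q) * E = (LinearMap.mulLeft ℂ (p ⊗ₜ[ℂ] (1 : A)) ∘ₗ σ.toLinearMap)
        (LinearMap.rTensor A (m.flip.flip q) (σ E)) := by
      rw [LinearMap.flip_flip, rTensor_comm, lTensor_mul, LinearMap.comp_apply,
        LinearEquiv.coe_coe, hσσ, LinearMap.mulLeft_apply, ← mul_assoc]
      simp
    rw [hpq, ← Submodule.mem_comap]
    refine Submodule.span_le.mpr ?_ key
    rintro _ ⟨a, b, rfl⟩
    refine ⟨(p * b) ⊗ₜ a, ?_⟩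
    rw [LinearMap.flip_flip, LinearMap.comp_apply, LinearMap.comp_apply, LinearEquiv.coe_coe,
      lTensor_comm, hσσ, rTensor_mul]
    simp [Tmap2, ← mul_assoc]
  · intro x y
    simp [Tmap4, ← mul_assoc, (hEΔ _).1]
  · intro p q
    have key := rTensor_mem_span_of_faithful (σ.toLinearMap ∘ₗ Δ) m
      (fun x y z => mul_assoc x y z)
      (fun x y => (congrArg σ (hmul x y)).trans (comm_map₂ m _ _))
      hcoσ hfullσL hfullσR (σ E)
      (C.val.toLinearMap ∘ₗ SC.symm.toLinearMap) B.val.toLinearMap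
      (B.val.toLinearMap ∘ₗ SB.symm.toLinearMap)
      (fun b a => by
        rw [LinearMap.comp_apply, LinearEquiv.coe_coe, lTensor_comm, rTensor_comm,
          rTensor_mul, lTensor_mul]
        have h := hleft (SC.symm b) a
        rw [LinearEquiv.apply_symm_apply] at h
        exact congrArg σ h.symm) (TensorProduct.comm ℂ B C E')
      (by rw [hmapσ, hmapG'])
      {φ | IsRightIntegral A Δ B φ}
      (fun φ h a => by
        rw [LinearMap.comp_apply, LinearMap.comp_apply, LinearEquiv.coe_coe, sL_comm,
          rTensor_comm, lTensor_mul_flip]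
        exact congrArg σ (hB ⟨_, h.2 a⟩).2) hψ.1 q
    have hpq : E * (p ⊗ₜ[ℂ] q) = (LinearMap.mulRight ℂ (p ⊗ₜ[ℂ] (1 : A)) ∘ₗ σ.toLinearMap)
        (LinearMap.rTensor A (m.flip q) (σ E)) := by
      rw [rTensor_comm, lTensor_mul_flip, LinearMap.comp_apply,
        LinearEquiv.coe_coe, hσσ, LinearMap.mulRight_apply, mul_assoc]
      simp
    rw [hpq, ← Submodule.mem_comap]
    refine Submodule.span_le.mpr ?_ key
    rintro _ ⟨a, b, rfl⟩
    refine ⟨(b * p) ⊗ₜ a, ?_⟩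
    rw [LinearMap.comp_apply, LinearMap.comp_apply, LinearEquiv.coe_coe,
      lTensor_comm, hσσ, rTensor_mul_flip]
    simp [Tmap4, mul_assoc]
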